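/- Let λ be a regular uncountable cardinal and let G be a λ-free abelian group. Then for every cardinal μ < λ, the group G is strongly μ-free: every subgroup of G of cardinality strictly less than μ is contained in a subgroup H of G of cardinality strictly less than μ such that H is a free abelian group and the quotient G/H is μ-free. -/

import Mathlib

universe u

/-- An abelian group `G` is `κ`-free if every subgroup of cardinality `< κ`
is a free abelian group (free `ℤ`-module). -/
def IsKappaFree (κ : Cardinal.{u}) (G : Type u) [AddCommGroup G] : Prop :=
  ∀ H : AddSubgroup G, Cardinal.mk H < κ → Module.Free ℤ H

open Cardinal Set Order

/-- A quotient by the kernel of a homomorphism is free iff the image is. -/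
theorem free_quotient_iff_free_range {X Y : Type*} [AddCommGroup X] [AddCommGroup Y]
    (f : X →+ Y) {N : AddSubgroup X} (h : f.ker = N) :
    Module.Free ℤ (X ⧸ N) ↔ Module.Free ℤ f.range := by
  subst h
  exact Module.Free.iff_of_equiv (QuotientAddGroup.quotientKerEquivRange f).toIntLinearEquiv

/-- An extension of a free abelian group by a free abelian group is free. -/
theorem free_of_surjective_of_free_ker {X Y : Type*} [AddCommGroup X] [AddCommGroup Y]
    (f : X →+ Y) (hf : Function.Surjective f) [Module.Free ℤ Y] [Module.Free ℤ f.ker] :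
    Module.Free ℤ X := by
  obtain ⟨s, hs⟩ := f.toIntLinearMap.exists_rightInverse_of_surjective
    (LinearMap.range_eq_top.2 hf)
  have hs' : ∀ y, f (s y) = y := fun y => LinearMap.congr_fun hs y
  let e : (f.ker × Y) ≃+ X :=
    AddEquiv.ofBijective (f.ker.subtype.coprod s.toAddMonoidHom) (by
      constructor
      · rw [injective_iff_map_eq_zero]
        rintro ⟨⟨a, ha⟩, y⟩ h
        have h0 : a + s y = 0 := h
        have h1 := congrArg f h0
        rw [map_add, hs', (AddMonoidHom.mem_ker).1 ha, zero_add, map_zero] at h1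
        subst h1
        simpa using h0
      · intro x
        exact ⟨(⟨x - s (f x), by simp [AddMonoidHom.mem_ker, hs']⟩, f x),
          sub_add_cancel x (s (f x))⟩)
  exact Module.Free.of_equiv e.toIntLinearEquiv

/-- If `K ≤ P` and both `P / K` and `G / P` are free, then so is `G / K`. -/
theorem free_quotient_trans {G : Type*} [AddCommGroup G] {K P : AddSubgroup G} (h : K ≤ P)
    (hP : Module.Free ℤ (P ⧸ K.addSubgroupOf P)) [Module.Free ℤ (G ⧸ P)] :
    Module.Free ℤ (G ⧸ K) := by
  let f : G ⧸ K →+ G ⧸ P := QuotientAddGroup.map K P (AddMonoidHom.id G) h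
  have hf : Function.Surjective f := by
    intro y
    obtain ⟨x, rfl⟩ := QuotientAddGroup.mk_surjective y
    exact ⟨x, rfl⟩
  have hker : f.ker = ((QuotientAddGroup.mk' K).comp P.subtype).range := by
    ext y
    obtain ⟨x, rfl⟩ := QuotientAddGroup.mk_surjective y
    have h1 : f x = (x : G ⧸ P) := rfl
    rw [AddMonoidHom.mem_ker, h1, QuotientAddGroup.eq_zero_iff]
    constructor
    · exact fun hx => ⟨⟨x, hx⟩, rfl⟩
    · rintro ⟨⟨z, hz⟩, hzx⟩
      have h2 : (z : G ⧸ K) = x := hzx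
      rw [QuotientAddGroup.eq] at h2
      simpa using P.add_mem hz (h h2)
  have : Module.Free ℤ f.ker := by
    rw [hker]
    refine (free_quotient_iff_free_range _ ?_).1 hP
    rw [← AddMonoidHom.comap_ker, QuotientAddGroup.ker_mk']
    rfl
  exact free_of_surjective_of_free_ker f hf

/-- If all subgroups of `M` are free and `M / K` is free, then `L / K` is free for every `L` between
`K` and `M`. -/
theorem free_quotient_of_le {G : Type*} [AddCommGroup G] {K L M : AddSubgroup G} (hLM : L ≤ M)
    (hM : ∀ N : AddSubgroup M, Module.Free ℤ N) [Module.Free ℤ (M ⧸ K.addSubgroupOf M)] :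
    Module.Free ℤ (L ⧸ K.addSubgroupOf L) := by
  let q := QuotientAddGroup.mk' (K.addSubgroupOf M)
  obtain ⟨s, hs⟩ := q.toIntLinearMap.exists_rightInverse_of_surjective
    (LinearMap.range_eq_top.2 (QuotientAddGroup.mk'_surjective _))
  have hinj : Function.Injective s := Function.LeftInverse.injective (LinearMap.congr_fun hs)
  let f : L →+ M := s.toAddMonoidHom.comp (q.comp (AddSubgroup.inclusion hLM))
  refine (free_quotient_iff_free_range f ?_).2 (hM _)
  ext x
  have h1 : f x = s (q (AddSubgroup.inclusion hLM x)) := rfl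
  rw [AddMonoidHom.mem_ker, h1, map_eq_zero_iff s hinj, ← AddMonoidHom.mem_ker,
    QuotientAddGroup.ker_mk']
  rfl

/-- The quotient of a free abelian group by the span of a part of a basis is free. -/
theorem free_quotient_span_basis {G ι : Type*} [AddCommGroup G] (b : Module.Basis ι ℤ G)
    (S : Set ι) : Module.Free ℤ (G ⧸ (Submodule.span ℤ (b '' S)).toAddSubgroup) := by
  have hc : IsCompl (Submodule.span ℤ (b '' S)) (Submodule.span ℤ (b '' Sᶜ)) := by
    constructor
    · exact b.linearIndependent.disjoint_span_image disjoint_compl_right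
    · rw [codisjoint_iff, ← Submodule.span_union, ← image_union, union_compl_self, image_univ,
        b.span_eq]
  have : Module.Free ℤ (Submodule.span ℤ (b '' Sᶜ)) := by
    have h := (b.linearIndependent.comp ((↑) : (Sᶜ : Set ι) → ι) Subtype.val_injective)
    have h2 := Module.Free.of_basis (Module.Basis.span h)
    rwa [range_comp, Subtype.range_coe] at h2
  exact Module.Free.of_equiv (Submodule.quotientEquivOfIsCompl _ _ hc).symm

theorem mk_closure_le {G : Type u} [AddCommGroup G] {κ : Cardinal.{u}} (hκ : ℵ₀ ≤ κ) {s : Set G}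
    (hs : #s ≤ κ) : #(AddSubgroup.closure s) ≤ κ := by
  rcases isEmpty_or_nonempty s with h | h
  · rw [isEmpty_coe_sort.1 h, AddSubgroup.closure_empty]
    exact (mk_le_one_iff_set_subsingleton.2 subsingleton_singleton).trans (one_le_aleph0.trans hκ)
  · have hle : AddSubgroup.closure s ≤ (FreeAbelianGroup.lift ((↑) : s → G)).range :=
      (AddSubgroup.closure_le _).2 fun x hx =>
        ⟨FreeAbelianGroup.of ⟨x, hx⟩, FreeAbelianGroup.lift_apply_of _ _⟩
    calc #(AddSubgroup.closure s) ≤ #(FreeAbelianGroup.lift ((↑) : s → G)).range :=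
          mk_le_of_injective (AddSubgroup.inclusion_injective hle)
      _ ≤ #(FreeAbelianGroup s) := mk_range_le
      _ = max #s ℵ₀ := mk_freeAbelianGroup s
      _ ≤ κ := max_le hs hκ

theorem mk_iSup_le {G ι : Type u} [AddCommGroup G] {κ : Cardinal.{u}} (hκ : ℵ₀ ≤ κ) (hι : #ι ≤ κ)
    {A : ι → AddSubgroup G} (hA : ∀ i, #(A i) ≤ κ) : #(⨆ i, A i : AddSubgroup G) ≤ κ := by
  rw [AddSubgroup.iSup_eq_closure]
  refine mk_closure_le hκ ((mk_iUnion_le _).trans ?_)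
  exact (mul_le_mul' hι (ciSup_le' hA)).trans (mul_eq_self hκ).le

theorem mk_sup_le {G : Type u} [AddCommGroup G] {κ : Cardinal.{u}} (hκ : ℵ₀ ≤ κ)
    {A B : AddSubgroup G} (hA : #A ≤ κ) (hB : #B ≤ κ) : #(A ⊔ B : AddSubgroup G) ≤ κ := by
  rw [AddSubgroup.sup_eq_closure]
  exact mk_closure_le hκ ((mk_union_le _ _).trans (add_le_of_le hκ hA hB))

theorem IsKappaFree.free_quotient {κ : Cardinal.{u}} {G : Type u} [AddCommGroup G]
    {H L : AddSubgroup G} (h : IsKappaFree κ (G ⧸ H)) (hL : #L < κ) :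
    Module.Free ℤ (L ⧸ H.addSubgroupOf L) := by
  refine (free_quotient_iff_free_range ((QuotientAddGroup.mk' H).comp L.subtype) ?_).2
    (h _ (mk_range_le.trans_lt hL))
  rw [← AddMonoidHom.comap_ker, QuotientAddGroup.ker_mk']
  rfl

theorem exists_not_free_quotient {κ : Cardinal.{u}} (hκ : ℵ₀ ≤ κ) {G : Type u} [AddCommGroup G]
    {H : AddSubgroup G} (hH : #H < κ) (h : ¬ IsKappaFree κ (G ⧸ H)) :
    ∃ L : AddSubgroup G, H ≤ L ∧ #L < κ ∧ ¬ Module.Free ℤ (L ⧸ H.addSubgroupOf L) := by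
  simp only [IsKappaFree, not_forall] at h
  obtain ⟨A, hA, hnf⟩ := h
  let f := (QuotientAddGroup.mk' H).comp (A.comap (QuotientAddGroup.mk' H)).subtype
  have hker : f.ker = H.addSubgroupOf (A.comap (QuotientAddGroup.mk' H)) := by
    rw [← AddMonoidHom.comap_ker, QuotientAddGroup.ker_mk']
    rfl
  have hrange : f.range = A := by
    rw [AddMonoidHom.range_comp, AddSubgroup.range_subtype,
      AddSubgroup.map_comap_eq_self_of_surjective (QuotientAddGroup.mk'_surjective H)]
  have hHL : H ≤ A.comap (QuotientAddGroup.mk' H) := by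
    intro x hx
    rw [AddSubgroup.mem_comap, QuotientAddGroup.mk'_apply, (QuotientAddGroup.eq_zero_iff x).2 hx]
    exact A.zero_mem
  refine ⟨A.comap (QuotientAddGroup.mk' H), hHL, ?_, ?_⟩
  · rw [mk_congr (AddSubgroup.addGroupEquivQuotientProdAddSubgroup
      (s := H.addSubgroupOf (A.comap (QuotientAddGroup.mk' H)))), mk_prod, lift_id, lift_id]
    refine mul_lt_of_lt hκ ?_ ?_
    · rw [← hker, mk_congr (QuotientAddGroup.quotientKerEquivRange f).toEquiv, hrange]
      exact hA
    · exact (mk_congr (AddSubgroup.addSubgroupOfEquivOfLe hHL).toEquiv).trans_lt hH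
  · rwa [free_quotient_iff_free_range f hker, hrange]

/-- A well-order of type `κ⁺`, described by the properties used to build and to
interpolate filtrations of length `κ⁺`. -/
structure IsSuccWellOrder (κ : Cardinal.{u}) (W : Type u) [LinearOrder W] : Prop where
  wf : WellFoundedLT W
  mk_le : #W ≤ succ κ
  le_mk : succ κ ≤ #W
  mk_Iio_le : ∀ a : W, #(Iio a) ≤ κ
  exists_gt : ∀ S : Set W, #S ≤ κ → ∃ a, ∀ s ∈ S, s < a

theorem isSuccWellOrder_toType {κ : Cardinal.{u}} (hκ : ℵ₀ ≤ κ) :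
    IsSuccWellOrder κ (succ κ).ord.ToType where
  wf := inferInstance
  mk_le := (mk_ord_toType _).le
  le_mk := (mk_ord_toType _).ge
  mk_Iio_le a := by
    have h := mk_Iio_lt a (by simp)
    rw [mk_ord_toType] at h
    exact lt_succ_iff.1 h
  exists_gt S hS := by
    by_contra! h
    have h1 := Order.cof_le (s := S) h
    rw [Ordinal.cof_toType, (isRegular_succ hκ).cof_ord] at h1
    exact (lt_succ κ).not_ge (h1.trans hS)

/-- An ascending family of subgroups of cardinality at most `κ`, continuous at limits. -/
structure IsContinuousChain (κ : Cardinal.{u}) {W G : Type u} [LinearOrder W] [AddCommGroup G]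
    (K : W → AddSubgroup G) : Prop where
  mono : Monotone K
  mk_le : ∀ a, #(K a) ≤ κ
  cont : ∀ d, Order.IsSuccLimit d → ∀ x ∈ K d, ∃ c < d, x ∈ K c

/-- Let `H` be the union of a filtration of length `κ⁺` in a free abelian group. If subgroups of
cardinality at most `κ` have free image modulo `H`, then some member of the filtration has a free
quotient. -/
theorem IsContinuousChain.exists_free_quotient {κ : Cardinal.{u}} (hκ : ℵ₀ ≤ κ) {W G : Type u}
    [LinearOrder W] [AddCommGroup G] (hW : IsSuccWellOrder κ W) {K : W → AddSubgroup G}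
    (hK : IsContinuousChain κ K) {H : AddSubgroup G} (hH : ∀ x, x ∈ H ↔ ∃ a, x ∈ K a)
    [Module.Free ℤ G]
    (hgood : ∀ P : AddSubgroup G, #P ≤ κ → Module.Free ℤ (P ⧸ H.addSubgroupOf P)) :
    ∃ a, Module.Free ℤ (G ⧸ K a) := by
  have := hW.wf
  let b := Module.Free.chooseBasis ℤ G
  let σ : AddSubgroup G → Set (Module.Free.ChooseBasisIndex ℤ G) :=
    fun A => ⋃ x : A, ↑(b.repr x).support
  have hσ : ∀ {A B : AddSubgroup G}, A ≤ B → σ A ⊆ σ B := fun h =>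
    iUnion_subset fun x => subset_iUnion_of_subset ⟨x.1, h x.2⟩ subset_rfl
  let P : AddSubgroup G → AddSubgroup G := fun A => (Submodule.span ℤ (b '' σ A)).toAddSubgroup
  have mem_P : ∀ {A x}, x ∈ P A ↔ ↑(b.repr x).support ⊆ σ A := b.mem_span_image
  have le_P : ∀ A, A ≤ P A := fun A x hx =>
    mem_P.2 (subset_iUnion_of_subset (⟨x, hx⟩ : A) subset_rfl)
  have mk_P : ∀ A : AddSubgroup G, #A ≤ κ → #(P A) ≤ κ := by
    intro A hA
    have h1 : P A = AddSubgroup.closure (b '' σ A) := Submodule.span_int_eq_addSubgroupClosure _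
    rw [h1]
    refine mk_closure_le hκ (mk_image_le.trans ((mk_iUnion_le _).trans ?_))
    refine (mul_le_mul' hA (ciSup_le' fun x => ?_)).trans (mul_eq_self hκ).le
    exact (lt_aleph0_of_finite _).le.trans hκ
  have step : ∀ a, ∃ c, a < c ∧ ∀ x ∈ P (K a), x ∈ H → x ∈ K c := by
    intro a
    choose r hr using fun x : {x : P (K a) // (x : G) ∈ H} => (hH x).1 x.2
    obtain ⟨c, hc⟩ := hW.exists_gt (insert a (range r)) (by
      refine mk_insert_le.trans (add_le_of_le hκ ?_ (one_le_aleph0.trans hκ))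
      exact mk_range_le.trans ((mk_subtype_le _).trans (mk_P _ (hK.mk_le a))))
    exact ⟨c, hc a (mem_insert _ _), fun x hx hxH => hK.mono
      (hc _ (mem_insert_of_mem _ (mem_range_self ⟨⟨x, hx⟩, hxH⟩))).le (hr ⟨⟨x, hx⟩, hxH⟩)⟩
  choose g hg hgK using step
  obtain ⟨a₀, -⟩ := hW.exists_gt ∅ (by simp)
  let e : ℕ → W := fun n => g^[n] a₀
  have he : ∀ n, e (n + 1) = g (e n) := fun n => Function.iterate_succ_apply' g n a₀
  have e_lt : ∀ n, e n < e (n + 1) := fun n => (he n).symm ▸ hg (e n)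
  have e_mono : StrictMono e := strictMono_nat_of_lt_succ e_lt
  obtain ⟨d, hd, hmin⟩ : ∃ d, (∀ n, e n < d) ∧ ∀ c < d, ∃ n, c ≤ e n := by
    obtain ⟨u, hu⟩ := hW.exists_gt (range e) ((countable_range e).le_aleph0.trans hκ)
    obtain ⟨d, hd, hmin⟩ := WellFounded.has_min wellFounded_lt {d | ∀ n, e n < d}
      ⟨u, fun n => hu _ (mem_range_self n)⟩
    refine ⟨d, hd, fun c hc => ?_⟩
    by_contra! h
    exact hmin c h hc
  have hlim : Order.IsSuccLimit d := by
    refine ⟨fun h => (h (hd 0).le).not_gt (hd 0), fun c hc => ?_⟩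
    obtain ⟨n, hn⟩ := hmin c hc.lt
    exact hc.2 (hn.trans_lt (e_lt n)) (hd _)
  have mem_Kd : ∀ x ∈ K d, ∃ n, x ∈ K (e n) := by
    intro x hx
    obtain ⟨c, hc, hxc⟩ := hK.cont d hlim x hx
    obtain ⟨n, hn⟩ := hmin c hc
    exact ⟨n, hK.mono hn hxc⟩
  have mem_Pd : ∀ x ∈ P (K d), ∃ n, x ∈ P (K (e n)) := by
    intro x hx
    have h1 : ∀ i ∈ (b.repr x).support, ∃ n, i ∈ σ (K (e n)) := by
      intro i hi
      obtain ⟨y, hy⟩ := mem_iUnion.1 (mem_P.1 hx hi)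
      obtain ⟨n, hn⟩ := mem_Kd y y.2
      exact ⟨n, mem_iUnion.2 ⟨⟨y, hn⟩, hy⟩⟩
    choose! n hn using h1
    refine ⟨(b.repr x).support.sup n, mem_P.2 fun i hi => ?_⟩
    exact hσ (hK.mono (e_mono.monotone (Finset.le_sup hi))) (hn i hi)
  refine ⟨d, ?_⟩
  have hPH : (K d).addSubgroupOf (P (K d)) = H.addSubgroupOf (P (K d)) := by
    ext ⟨x, hx⟩
    rw [AddSubgroup.mem_addSubgroupOf, AddSubgroup.mem_addSubgroupOf]
    refine ⟨fun h => (hH x).2 ⟨d, h⟩, fun h => ?_⟩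
    obtain ⟨n, hn⟩ := mem_Pd x hx
    exact hK.mono (hd (n + 1)).le (he n ▸ hgK _ x hn h)
  have := free_quotient_span_basis b (σ (K d))
  exact free_quotient_trans (P := P (K d)) (le_P _)
    (hPH ▸ hgood _ (mk_P _ (hK.mk_le d)))

/-- A filtration of length `κ⁺` of `H`, together with subgroups `L a` containing its members:
if all the `L a` lie in a subgroup `M` all of whose subgroups are free, and subgroups of `M` of
cardinality at most `κ` have free image modulo `H`, then some `L a / K a` is free. -/
theorem IsContinuousChain.exists_free_quotient_of_le {κ : Cardinal.{u}} (hκ : ℵ₀ ≤ κ) {W G : Type u}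
    [LinearOrder W] [AddCommGroup G] (hW : IsSuccWellOrder κ W) {K : W → AddSubgroup G}
    (hK : IsContinuousChain κ K) {H M : AddSubgroup G} (hH : ∀ x, x ∈ H ↔ ∃ a, x ∈ K a)
    (hM : ∀ N ≤ M, Module.Free ℤ N)
    (hgood : ∀ P ≤ M, #P ≤ κ → Module.Free ℤ (P ⧸ H.addSubgroupOf P))
    {L : W → AddSubgroup G} (hLM : ∀ a, L a ≤ M) :
    ∃ a, Module.Free ℤ (L a ⧸ (K a).addSubgroupOf (L a)) := by
  have hM' : ∀ N : AddSubgroup M, Module.Free ℤ N := fun N => by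
    have := hM (N.map M.subtype) (AddSubgroup.map_subtype_le N)
    exact Module.Free.of_equiv
      (N.equivMapOfInjective M.subtype M.subtype_injective).symm.toIntLinearEquiv
  have := hM M le_rfl
  have hK' : IsContinuousChain κ fun a => (K a).addSubgroupOf M :=
    { mono := fun a c h => AddSubgroup.comap_mono (hK.mono h)
      mk_le := fun a => (mk_le_of_injective (f := fun x : (K a).addSubgroupOf M =>
        (⟨x.1.1, x.2⟩ : K a)) fun x y h =>
          Subtype.ext (Subtype.ext (congrArg (fun z : K a => (z : G)) h))).trans (hK.mk_le a)
      cont := fun d hd x hx => hK.cont d hd x hx }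
  obtain ⟨a, ha⟩ := hK'.exists_free_quotient hκ hW (H := H.addSubgroupOf M)
    (fun x => hH x) (fun P hP => by
      have h1 := hgood (P.map M.subtype) (AddSubgroup.map_subtype_le P) (mk_image_le.trans hP)
      let i := P.equivMapOfInjective M.subtype M.subtype_injective
      refine (Module.Free.iff_of_equiv (QuotientAddGroup.congr _ _ i ?_).toIntLinearEquiv).2 h1
      ext x
      constructor
      · rintro ⟨y, hy, rfl⟩
        exact hy
      · exact fun hx => ⟨i.symm x, by
          obtain ⟨y, rfl⟩ := i.surjective x
          rw [i.symm_apply_apply]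
          exact hx, i.apply_symm_apply x⟩)
  exact ⟨a, free_quotient_of_le (hLM a) hM'⟩

theorem IsContinuousChain.of_le_iSup {κ : Cardinal.{u}} {W G : Type u} [LinearOrder W]
    [AddCommGroup G] {K : W → AddSubgroup G} (mono : Monotone K) (mk_le : ∀ a, #(K a) ≤ κ)
    (cont : ∀ d, IsSuccLimit d → K d ≤ ⨆ c : Iio d, K c) : IsContinuousChain κ K where
  mono := mono
  mk_le := mk_le
  cont d hd x hx := by
    obtain ⟨c₀, hc₀⟩ := not_isMin_iff.1 hd.not_isMin
    have : Nonempty (Iio d) := ⟨⟨c₀, hc₀⟩⟩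
    have hdir : Directed (· ≤ ·) fun c : Iio d => K c :=
      (mono.comp (Subtype.mono_coe (· ∈ Iio d))).directed_le
    obtain ⟨c, hc⟩ := (AddSubgroup.mem_iSup_of_directed hdir).1 (cont d hd hx)
    exact ⟨c, c.2, hc⟩

/-- If all subgroups of cardinality at most `κ⁺` are free, then every subgroup of cardinality at
most `κ` lies in one of cardinality at most `κ` with `κ⁺`-free quotient. -/
theorem exists_le_isKappaFree_succ_quotient {κ : Cardinal.{u}} (hκ : ℵ₀ ≤ κ) {G : Type u}
    [AddCommGroup G] (hG : ∀ N : AddSubgroup G, #N ≤ succ κ → Module.Free ℤ N)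
    {K : AddSubgroup G} (hK : #K ≤ κ) :
    ∃ H : AddSubgroup G, K ≤ H ∧ #H ≤ κ ∧ IsKappaFree (succ κ) (G ⧸ H) := by
  by_contra! hcon
  have hκ' : ℵ₀ ≤ succ κ := hκ.trans (le_succ κ)
  have hF : ∀ H : AddSubgroup G, ∃ L : AddSubgroup G, K ≤ H → #H ≤ κ →
      H ≤ L ∧ #L ≤ κ ∧ ¬ Module.Free ℤ (L ⧸ H.addSubgroupOf L) := by
    intro H
    by_cases h : K ≤ H ∧ #H ≤ κ
    · obtain ⟨L, h1, h2, h3⟩ :=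
        exists_not_free_quotient hκ' (lt_succ_iff.2 h.2) (hcon H h.1 h.2)
      exact ⟨L, fun _ _ => ⟨h1, lt_succ_iff.1 h2, h3⟩⟩
    · exact ⟨⊥, fun h1 h2 => (h ⟨h1, h2⟩).elim⟩
  choose F hF using hF
  have hW := isSuccWellOrder_toType hκ
  set W := (succ κ).ord.ToType
  let A : W → AddSubgroup G :=
    wellFounded_lt.fix fun a A => K ⊔ ⨆ c : Iio a, F (A c c.2)
  have hA : ∀ a, A a = K ⊔ ⨆ c : Iio a, F (A c) := fun a => wellFounded_lt.fix_eq _ a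
  have le_A : ∀ a, K ≤ A a := fun a => (hA a).symm ▸ le_sup_left
  have mk_A : ∀ a, #(A a) ≤ κ := by
    intro a
    induction a using WellFoundedLT.induction with
    | _ a ih =>
      rw [hA]
      exact mk_sup_le hκ hK (mk_iSup_le hκ (hW.mk_Iio_le a)
        fun c => (hF _ (le_A c) (ih c c.2)).2.1)
  have F_le : ∀ {a c}, c < a → F (A c) ≤ A a := fun {a c} h => by
    rw [hA a]
    exact (le_iSup (fun c : Iio a => F (A c)) ⟨c, h⟩).trans le_sup_right
  have le_F : ∀ a, A a ≤ F (A a) := fun a => (hF _ (le_A a) (mk_A a)).1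
  have mono : Monotone A := fun c a h => by
    rcases h.eq_or_lt with rfl | h
    · exact le_rfl
    · exact (le_F c).trans (F_le h)
  have hchain : IsContinuousChain κ A := .of_le_iSup mono mk_A fun d hd => by
    obtain ⟨c₀, hc₀⟩ := not_isMin_iff.1 hd.not_isMin
    have le_sup : ∀ c < d, A c ≤ ⨆ c : Iio d, A c := fun c hc =>
      le_iSup (fun c : Iio d => A c) ⟨c, hc⟩
    rw [hA d]
    refine sup_le ((le_A c₀).trans (le_sup c₀ hc₀)) (iSup_le fun c => ?_)
    obtain ⟨e, he, hce⟩ := hd.isSuccPrelimit.lt_iff_exists_lt.1 c.2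
    exact (F_le hce).trans (le_sup e he)
  have hfree : ∀ N ≤ ⨆ a, A a, Module.Free ℤ N := fun N hN =>
    hG N ((mk_le_of_injective (AddSubgroup.inclusion_injective hN)).trans
      (mk_iSup_le hκ' hW.mk_le fun a => (mk_A a).trans (le_succ κ)))
  obtain ⟨a₀, -⟩ := hW.exists_gt ∅ (by simp)
  have : Nonempty W := ⟨a₀⟩
  obtain ⟨a, ha⟩ := hchain.exists_free_quotient_of_le hκ hW
    (fun _ => AddSubgroup.mem_iSup_of_directed mono.directed_le) hfree
    (fun P hP _ => by
      rw [AddSubgroup.addSubgroupOf_eq_top.2 hP]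
      have : Subsingleton (P ⧸ (⊤ : AddSubgroup P)) := QuotientAddGroup.subsingleton_quotient_top
      exact Module.Free.of_subsingleton ℤ _)
    (L := fun a => F (A a)) (fun a => by
      obtain ⟨c, hc⟩ := hW.exists_gt {a} ((mk_singleton a).trans_le (one_le_aleph0.trans hκ))
      exact (F_le (hc a rfl)).trans (le_iSup A c))
  exact (hF _ (le_A a) (mk_A a)).2.2 ha

/-- If all subgroups of cardinality at most `μ` are free, and `H` is a subgroup of cardinality at
most `κ⁺ ≤ μ` with `κ⁺`-free quotient, then every subgroup of `H` of cardinality at most `κ` lies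
in one of cardinality at most `κ` with `μ`-free quotient. -/
theorem exists_le_isKappaFree_quotient_of_isKappaFree_succ {κ μ : Cardinal.{u}} (hκ : ℵ₀ ≤ κ)
    (hμ : succ κ ≤ μ) {G : Type u} [AddCommGroup G]
    (hG : ∀ N : AddSubgroup G, #N ≤ μ → Module.Free ℤ N) {K H : AddSubgroup G} (hKH : K ≤ H)
    (hK : #K ≤ κ) (hH : #H ≤ succ κ) (hGH : IsKappaFree (succ κ) (G ⧸ H)) :
    ∃ H' : AddSubgroup G, K ≤ H' ∧ #H' ≤ κ ∧ IsKappaFree μ (G ⧸ H') := by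
  by_contra! hcon
  have hW := isSuccWellOrder_toType hκ
  set W := (succ κ).ord.ToType
  obtain ⟨f⟩ : Nonempty (H ↪ W) := hH.trans hW.le_mk
  let s : W → Set G := fun a => (↑) '' (f ⁻¹' Iio a)
  let A : W → AddSubgroup G := fun a => K ⊔ AddSubgroup.closure (s a)
  have mk_A : ∀ a, #(A a) ≤ κ := fun a =>
    mk_sup_le hκ hK (mk_closure_le hκ (mk_image_le.trans
      ((mk_preimage_of_injective f (Iio a) f.injective).trans (hW.mk_Iio_le a))))
  have mono : Monotone A := fun c a h => sup_le_sup_left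
    (AddSubgroup.closure_mono (image_mono (preimage_mono (Iio_subset_Iio h)))) K
  have mem_A : ∀ {a} (x : H), f x < a → (x : G) ∈ A a := fun {a} x h =>
    (le_sup_right : _ ≤ A a) (AddSubgroup.subset_closure ⟨x, h, rfl⟩)
  have hchain : IsContinuousChain κ A := .of_le_iSup mono mk_A fun d hd => by
    obtain ⟨c₀, hc₀⟩ := not_isMin_iff.1 hd.not_isMin
    have le_sup : ∀ c < d, A c ≤ ⨆ c : Iio d, A c := fun c hc =>
      le_iSup (fun c : Iio d => A c) ⟨c, hc⟩
    refine sup_le ((le_sup_left : K ≤ A c₀).trans (le_sup c₀ hc₀))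
      ((AddSubgroup.closure_le _).2 ?_)
    rintro _ ⟨x, hx, rfl⟩
    obtain ⟨e, he, hxe⟩ := hd.isSuccPrelimit.lt_iff_exists_lt.1 hx
    exact le_sup e he (mem_A x hxe)
  have A_le : ∀ a, A a ≤ H := fun a => sup_le hKH ((AddSubgroup.closure_le _).2 (by
    rintro _ ⟨x, -, rfl⟩
    exact x.2))
  have hμ' : ℵ₀ ≤ μ := (hκ.trans (le_succ κ)).trans hμ
  choose L _ hLμ hL using fun a => exists_not_free_quotient hμ'
    (((mk_A a).trans_lt (lt_succ κ)).trans_le hμ) (hcon (A a) le_sup_left (mk_A a))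
  have hfree : ∀ N ≤ H ⊔ ⨆ a, L a, Module.Free ℤ N := fun N hN =>
    hG N ((mk_le_of_injective (AddSubgroup.inclusion_injective hN)).trans
      (mk_sup_le hμ' (hH.trans hμ) (mk_iSup_le hμ' (hW.mk_le.trans hμ) fun a => (hLμ a).le)))
  have mem_H : ∀ x, x ∈ H ↔ ∃ a, x ∈ A a := fun x => by
    refine ⟨fun hx => ?_, fun ⟨a, ha⟩ => A_le a ha⟩
    obtain ⟨a, ha⟩ := hW.exists_gt {f ⟨x, hx⟩}
      ((mk_singleton _).trans_le (one_le_aleph0.trans hκ))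
    exact ⟨a, mem_A ⟨x, hx⟩ (ha _ rfl)⟩
  obtain ⟨a, ha⟩ := hchain.exists_free_quotient_of_le hκ hW mem_H hfree
    (fun P _ hP => hGH.free_quotient (lt_succ_iff.2 hP))
    (fun a => (le_iSup L a).trans le_sup_right)
  exact hL a ha

theorem exists_le_isKappaFree_quotient {κ μ : Cardinal.{u}} (hκ : ℵ₀ ≤ κ) (hμ : κ < μ)
    {G : Type u} [AddCommGroup G] (hG : ∀ N : AddSubgroup G, #N ≤ μ → Module.Free ℤ N)
    {K : AddSubgroup G} (hK : #K ≤ κ) :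
    ∃ H : AddSubgroup G, K ≤ H ∧ #H ≤ κ ∧ IsKappaFree μ (G ⧸ H) := by
  rcases (succ_le_of_lt hμ).eq_or_lt with rfl | h
  · exact exists_le_isKappaFree_succ_quotient hκ hG hK
  · obtain ⟨H, hKH, hH, hGH⟩ := exists_le_isKappaFree_succ_quotient (hκ.trans (le_succ κ))
      (fun N hN => hG N (hN.trans (succ_le_of_lt h))) (hK.trans (le_succ κ))
    exact exists_le_isKappaFree_quotient_of_isKappaFree_succ hκ h.le hG hKH hK hH
      fun N hN => hGH N (hN.trans (lt_succ _))

theorem Module.Free.subsingleton_of_finite (M : Type*) [AddCommGroup M] [Module.Free ℤ M]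
    [Finite M] : Subsingleton M := by
  by_contra h
  rw [not_subsingleton_iff_nontrivial] at h
  exact (Module.Free.infinite ℤ M).not_finite ‹_›

/-- `ℵ₀`-freeness passes to quotients by finite subgroups. -/
theorem isKappaFree_aleph0_quotient {G : Type u} [AddCommGroup G] (hG : IsKappaFree ℵ₀ G)
    {K : AddSubgroup G} (hK : #K < ℵ₀) : IsKappaFree ℵ₀ (G ⧸ K) := by
  by_contra h
  obtain ⟨L, -, hL, hnf⟩ := exists_not_free_quotient le_rfl hK h
  have := hG L hL
  have := lt_aleph0_iff_finite.1 hL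
  have := Module.Free.subsingleton_of_finite L
  have : Subsingleton (L ⧸ K.addSubgroupOf L) := QuotientAddGroup.mk_surjective.subsingleton
  exact hnf (Module.Free.of_subsingleton ℤ _)

theorem strongly_mu_free_of_lambda_free
    (lam : Cardinal.{u}) (hreg : lam.IsRegular) (hunc : Cardinal.aleph 0 < lam)
    (G : Type u) [AddCommGroup G] (hfree : IsKappaFree lam G) :
    ∀ μ : Cardinal.{u}, μ < lam →
      ∀ K : AddSubgroup G, Cardinal.mk K < μ →
        ∃ H : AddSubgroup G, K ≤ H ∧ Cardinal.mk H < μ ∧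
          Module.Free ℤ H ∧ IsKappaFree μ (G ⧸ H) := by
  intro μ hμ K hK
  rw [aleph_zero] at hunc
  rcases le_or_gt μ ℵ₀ with h | h
  · exact ⟨K, le_rfl, hK, hfree K (hK.trans hμ), fun N hN => isKappaFree_aleph0_quotient
      (fun N hN => hfree N (hN.trans hunc)) (hK.trans_le h) N (hN.trans_le h)⟩
  · obtain ⟨H, hKH, hH, hGH⟩ := exists_le_isKappaFree_quotient (κ := max #K ℵ₀)
      (le_max_right _ _) (max_lt hK h) (fun N hN => hfree N (hN.trans_lt hμ)) (le_max_left _ _)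
    have hHμ := hH.trans_lt (max_lt hK h)
    exact ⟨H, hKH, hHμ, hfree H (hHμ.trans hμ), hGH⟩
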